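/- Let d ≥ 1 and 0 < α < 2. There exists a constant c₁ > 0 depending only on α and d such that for every smooth ℤ^d-periodic function f : ℝ^d → ℝ with mean zero and every 1 < q < ∞, one has ∫_{[0,1]^d} (|∇|^α f)(x) |f(x)|^{q-2} f(x) dx ≥ c₁ ‖f‖_{L^q([0,1]^d)}^q. -/

import Mathlib

open MeasureTheory
open scoped ENNReal

noncomputable section

/-- e^{2π i θ} -/
def fchar (θ : ℝ) : ℂ := Complex.exp (((2 * Real.pi * θ : ℝ) : ℂ) * Complex.I)

/-- the fundamental cell [0,1]^d -/
def cube (d : ℕ) : Set (Fin d → ℝ) := Set.univ.pi fun _ => Set.Icc (0 : ℝ) 1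

/-- Fourier coefficient f̂(n) = ∫_{[0,1]^d} f(x) e^{-2πi n·x} dx -/
def fCoeff (d : ℕ) (f : (Fin d → ℝ) → ℝ) (n : Fin d → ℤ) : ℂ :=
  ∫ x in cube d, (f x : ℂ) * fchar (-(∑ i, (n i : ℝ) * x i))

/-- fractional Laplacian of a smooth periodic function:
(|∇|^α f)(x) = ∑_{n ∈ ℤ^d} (2π|n|)^α f̂(n) e^{2πi n·x} -/
def fracLapPer (d : ℕ) (α : ℝ) (f : (Fin d → ℝ) → ℝ) (x : Fin d → ℝ) : ℝ :=
  (∑' n : Fin d → ℤ,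
      (((2 * Real.pi * Real.sqrt (∑ i, (n i : ℝ) ^ 2)) ^ α : ℝ) : ℂ) * fCoeff d f n *
        fchar (∑ i, (n i : ℝ) * x i)).re


/-! ### Periodic functions and the torus -/

/-- `ℤ^d`-periodicity of a function on `ℝ^d`. -/
def IntPeriodic {d : ℕ} {E : Type*} (h : (Fin d → ℝ) → E) : Prop :=
  ∀ (x : Fin d → ℝ) (n : Fin d → ℤ), h (x + fun i => (n i : ℝ)) = h x

/-- The projection `ℝ^d → (ℝ/ℤ)^d`. -/
def torusMk {d : ℕ} (x : Fin d → ℝ) : UnitAddTorus (Fin d) := fun i => (x i : UnitAddCircle)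

lemma isOpenQuotientMap_torusMk {d : ℕ} :
    IsOpenQuotientMap (torusMk : (Fin d → ℝ) → UnitAddTorus (Fin d)) :=
  IsOpenQuotientMap.piMap fun _ => QuotientAddGroup.isOpenQuotientMap_mk

lemma IntPeriodic.exists_torus_lift {d : ℕ} {E : Type*} [TopologicalSpace E]
    {h : (Fin d → ℝ) → E} (hp : IntPeriodic h) (hc : Continuous h) :
    ∃ H : C(UnitAddTorus (Fin d), E), ∀ x, H (torusMk x) = h x := by
  let p : C(Fin d → ℝ, UnitAddTorus (Fin d)) := ⟨torusMk, isOpenQuotientMap_torusMk.continuous⟩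
  have hq : Topology.IsQuotientMap p := isOpenQuotientMap_torusMk.isQuotientMap
  have hfac : ∀ a b : Fin d → ℝ, torusMk a = torusMk b → h a = h b := by
    intro a b hab
    have : ∀ i, ∃ m : ℤ, b i + m = a i := by
      intro i
      have h1 : ((a i : ℝ) : UnitAddCircle) = (b i : ℝ) := congrFun hab i
      obtain ⟨m, hm⟩ := (AddCircle.coe_eq_zero_iff (1 : ℝ) (x := a i - b i)).1 (by
        rw [AddCircle.coe_sub, h1, sub_self])
      exact ⟨m, by simp at hm; linarith⟩
    choose m hm using this
    rw [← hp b m]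
    congr 1
    ext i
    simp [hm]
  exact ⟨hq.lift ⟨h, hc⟩ fun a b => hfac a b,
    fun x => DFunLike.congr_fun (hq.lift_comp ⟨h, hc⟩ fun a b => hfac a b) x⟩

lemma measurePreserving_torusMk (d : ℕ) :
    MeasurePreserving (torusMk : (Fin d → ℝ) → UnitAddTorus (Fin d))
      (volume.restrict (cube d)) volume := by
  have h := measurePreserving_pi (fun _ : Fin d => volume.restrict (Set.Ioc (0 : ℝ) (0 + 1)))
    (fun _ : Fin d => (volume : Measure UnitAddCircle))
    (fun _ => AddCircle.measurePreserving_mk (1 : ℝ) 0)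
  rw [← Measure.restrict_pi_pi] at h
  have e : (volume.restrict (cube d) : Measure (Fin d → ℝ)) =
      (Measure.pi fun _ : Fin d => (volume : Measure ℝ)).restrict
        (Set.univ.pi fun _ => Set.Ioc (0 : ℝ) (0 + 1)) := by
    rw [zero_add]
    rw [Measure.restrict_congr_set (Measure.univ_pi_Ioc_ae_eq_Icc
      (μ := fun _ : Fin d => (volume : Measure ℝ)) (f := fun _ => 0) (g := fun _ => 1)),
      cube, Set.pi_univ_Icc, volume_pi]
  rw [e]
  exact h

lemma IntPeriodic.setIntegral_add {d : ℕ} {E : Type*} [NormedAddCommGroup E] [NormedSpace ℝ E]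
    {h : (Fin d → ℝ) → E} (hp : IntPeriodic h) (hc : Continuous h) (y : Fin d → ℝ) :
    ∫ x in cube d, h (x + y) = ∫ x in cube d, h x := by
  obtain ⟨H, hH⟩ := hp.exists_torus_lift hc
  have key : ∀ G : C(UnitAddTorus (Fin d), E), ∫ x in cube d, G (torusMk x) = ∫ t, G t := by
    intro G
    rw [← (measurePreserving_torusMk d).map_eq,
      integral_map (measurePreserving_torusMk d).measurable.aemeasurable
        G.continuous.aestronglyMeasurable]
  have hadd : ∀ x, h (x + y) = H (torusMk x + torusMk y) := fun x => by
    rw [← hH]; rfl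
  simp_rw [hadd, ← hH]
  rw [key H]
  exact (key ⟨fun t => H (t + torusMk y), by fun_prop⟩).trans
    (integral_add_right_eq_self (fun t => H t) (torusMk y))

lemma IntPeriodic.exists_norm_le {d : ℕ} {E : Type*} [NormedAddCommGroup E]
    {h : (Fin d → ℝ) → E} (hp : IntPeriodic h) (hc : Continuous h) :
    ∃ C, 0 ≤ C ∧ ∀ x, ‖h x‖ ≤ C := by
  obtain ⟨H, hH⟩ := hp.exists_torus_lift hc
  exact ⟨‖H‖, norm_nonneg _, fun x => hH x ▸ H.norm_coe_le_norm _⟩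

lemma isCompact_cube (d : ℕ) : IsCompact (cube d) := isCompact_univ_pi fun _ => isCompact_Icc

lemma measurableSet_cube (d : ℕ) : MeasurableSet (cube d) := (isCompact_cube d).measurableSet

lemma volume_cube (d : ℕ) : volume (cube d) = 1 := by
  simp [cube, Real.volume_Icc_pi]

instance isProbabilityMeasure_cube (d : ℕ) :
    IsProbabilityMeasure ((volume : Measure (Fin d → ℝ)).restrict (cube d)) :=
  ⟨by simp [volume_cube]⟩

lemma Continuous.integrableOn_cube {d : ℕ} {E : Type*} [NormedAddCommGroup E]
    {h : (Fin d → ℝ) → E} (hc : Continuous h) : IntegrableOn h (cube d) :=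
  hc.continuousOn.integrableOn_compact (isCompact_cube d)

/-- The integral of a directional derivative of a periodic function vanishes. -/
lemma IntPeriodic.setIntegral_deriv_eq_zero {d : ℕ} {h h' : (Fin d → ℝ) → ℂ} (hp : IntPeriodic h)
    (hc : Continuous h) (hp' : IntPeriodic h') (hc' : Continuous h') (v : Fin d → ℝ)
    (hd : ∀ x, HasDerivAt (fun t : ℝ => h (x + t • v)) (h' x) 0) :
    ∫ x in cube d, h' x = 0 := by
  obtain ⟨C, -, hC⟩ := hp'.exists_norm_le hc'
  have hd' : ∀ x, ∀ t : ℝ, HasDerivAt (fun t : ℝ => h (x + t • v)) (h' (x + t • v)) t := by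
    intro x t
    have h1 := hd (x + t • v)
    have h2 : HasDerivAt (fun s : ℝ => s - t) 1 t := (hasDerivAt_id t).sub_const t
    have h3 := HasDerivAt.scomp (h := fun s : ℝ => s - t) t (by simpa using h1) h2
    convert! h3 using 1
    · ext s
      simp only [Function.comp]
      congr 1
      module
    · simp
  have key := (hasDerivAt_integral_of_dominated_loc_of_deriv_le
    (μ := volume.restrict (cube d)) (F := fun (t : ℝ) x => h (x + t • v))
    (F' := fun (t : ℝ) x => h' (x + t • v)) (x₀ := 0) (s := Set.univ) (bound := fun _ => C)
    Filter.univ_mem (Filter.Eventually.of_forall fun t => by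
      have : Continuous fun x => h (x + t • v) := by fun_prop
      exact this.aestronglyMeasurable)
    (Continuous.integrableOn_cube (by fun_prop))
    (by
      have : Continuous fun x => h' (x + (0 : ℝ) • v) := by fun_prop
      exact this.aestronglyMeasurable)
    (Filter.Eventually.of_forall fun x t _ => hC _) (integrable_const _)
    (Filter.Eventually.of_forall fun x t _ => hd' x t)).2
  have hconst : (fun t : ℝ => ∫ x in cube d, h (x + t • v)) = fun _ => ∫ x in cube d, h x := by
    ext t
    exact hp.setIntegral_add hc _
  rw [hconst] at key
  simpa using key.unique (hasDerivAt_const _ _)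

/-! ### Characters and Fourier coefficients -/

lemma fchar_zero : fchar 0 = 1 := by simp [fchar]

lemma fchar_add (s t : ℝ) : fchar (s + t) = fchar s * fchar t := by
  rw [fchar, fchar, fchar, ← Complex.exp_add]
  congr 1
  push_cast
  ring

lemma fchar_intCast (m : ℤ) : fchar m = 1 := by
  rw [fchar, Complex.exp_eq_one_iff]
  exact ⟨m, by push_cast; ring⟩

lemma norm_fchar (t : ℝ) : ‖fchar t‖ = 1 := Complex.norm_exp_ofReal_mul_I _

lemma fchar_add_fchar_neg (t : ℝ) :
    fchar t + fchar (-t) = ((2 * Real.cos (2 * Real.pi * t) : ℝ) : ℂ) := by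
  rw [fchar, fchar]
  push_cast
  rw [Complex.two_cos]
  congr 2
  ring

@[fun_prop]
lemma continuous_fchar : Continuous fchar := by
  unfold fchar
  fun_prop

/-- The pairing `n · x` of a frequency with a point. -/
def dotInt {d : ℕ} (n : Fin d → ℤ) (x : Fin d → ℝ) : ℝ := ∑ i, (n i : ℝ) * x i

@[fun_prop]
lemma continuous_dotInt {d : ℕ} (n : Fin d → ℤ) : Continuous (dotInt n) := by
  unfold dotInt
  fun_prop

lemma dotInt_add {d : ℕ} (n : Fin d → ℤ) (x y : Fin d → ℝ) :
    dotInt n (x + y) = dotInt n x + dotInt n y := by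
  simp [dotInt, mul_add, Finset.sum_add_distrib]

lemma dotInt_neg {d : ℕ} (n : Fin d → ℤ) (x : Fin d → ℝ) : dotInt n (-x) = -dotInt n x := by
  simp [dotInt]

lemma dotInt_zero {d : ℕ} (n : Fin d → ℤ) : dotInt n 0 = 0 := by simp [dotInt]

lemma intPeriodic_fchar_neg_dotInt {d : ℕ} (n : Fin d → ℤ) :
    IntPeriodic fun x => fchar (-dotInt n x) := by
  intro x m
  have h : dotInt n (fun i => (m i : ℝ)) = ((∑ i, n i * m i : ℤ) : ℝ) := by
    simp [dotInt]
  simp only [dotInt_add, neg_add, h]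
  rw [fchar_add, ← Int.cast_neg, fchar_intCast, mul_one]

lemma mFourier_torusMk {d : ℕ} (n : Fin d → ℤ) (x : Fin d → ℝ) :
    UnitAddTorus.mFourier n (torusMk x) = fchar (dotInt n x) := by
  simp only [UnitAddTorus.mFourier, ContinuousMap.coe_mk, torusMk, fourier_coe_apply, fchar,
    dotInt, ← Complex.exp_sum]
  congr 1
  push_cast
  rw [Finset.mul_sum, Finset.sum_mul]
  refine Finset.sum_congr rfl fun i _ => ?_
  simp
  ring

lemma mFourierCoeff_eq_fCoeff {d : ℕ} {f : (Fin d → ℝ) → ℝ} {H : UnitAddTorus (Fin d) → ℂ}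
    (hH : ∀ x, H (torusMk x) = f x) (n : Fin d → ℤ) :
    UnitAddTorus.mFourierCoeff H n = fCoeff d f n := by
  rw [UnitAddTorus.mFourierCoeff_eq_integral H n 0]
  have hs : {x : Fin d → ℝ | ∀ i, x i ∈ Set.Ioc ((0 : Fin d → ℝ) i) ((0 : Fin d → ℝ) i + 1)} =
      Set.univ.pi fun _ => Set.Ioc (0 : ℝ) 1 := by
    ext x
    simp
  rw [hs, volume_pi, Measure.restrict_congr_set (Measure.univ_pi_Ioc_ae_eq_Icc
      (μ := fun _ : Fin d => (volume : Measure ℝ)) (f := fun _ => 0) (g := fun _ => 1)),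
      ← Set.pi_univ_Icc, ← volume_pi]
  refine integral_congr_ae (Filter.Eventually.of_forall fun x => ?_)
  have h1 := mFourier_torusMk (-n) x
  have h3 : dotInt (-n) x = -∑ i, (n i : ℝ) * x i := by simp [dotInt]
  rw [h3] at h1
  change UnitAddTorus.mFourier (-n) (torusMk x) * H (torusMk x) = _
  rw [h1, hH, mul_comm]

lemma IntPeriodic.hasSum_fourier {d : ℕ} {f : (Fin d → ℝ) → ℝ} (hp : IntPeriodic f)
    (hc : Continuous f) (hs : Summable fun n => ‖fCoeff d f n‖) (x : Fin d → ℝ) :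
    HasSum (fun n => fCoeff d f n * fchar (dotInt n x)) (f x : ℂ) := by
  have hp' : IntPeriodic fun x => (f x : ℂ) := fun x n => by simp only [hp x n]
  obtain ⟨H, hH⟩ := hp'.exists_torus_lift (by fun_prop)
  have hcoef : UnitAddTorus.mFourierCoeff H = fCoeff d f :=
    funext fun n => mFourierCoeff_eq_fCoeff hH n
  have h := UnitAddTorus.hasSum_mFourier_series_apply_of_summable (f := H)
    (by rw [hcoef]; exact hs.of_norm) (torusMk x)
  simpa only [hcoef, hH, mFourier_torusMk, smul_eq_mul] using h

lemma fCoeff_zero {d : ℕ} {f : (Fin d → ℝ) → ℝ} (hm : ∫ x in cube d, f x = 0) :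
    fCoeff d f 0 = 0 := by
  have h : ∫ x in cube d, (f x : ℂ) = 0 := by rw [integral_complex_ofReal, hm, Complex.ofReal_zero]
  simpa [fCoeff, fchar_zero] using h

lemma IntPeriodic.fderiv_apply {d : ℕ} {f : (Fin d → ℝ) → ℝ} (hp : IntPeriodic f)
    (v : Fin d → ℝ) : IntPeriodic fun x => fderiv ℝ f x v := by
  intro x n
  have : f = fun y => f (y + fun i => (n i : ℝ)) := funext fun y => (hp y n).symm
  conv_rhs => rw [this]
  simp only [fderiv_comp_add_right]

lemma fCoeff_fderiv {d : ℕ} {f : (Fin d → ℝ) → ℝ} (hf : ContDiff ℝ (⊤ : ℕ∞) f)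
    (hp : IntPeriodic f) (i : Fin d) (n : Fin d → ℤ) :
    fCoeff d (fun x => fderiv ℝ f x (Pi.single i 1)) n =
      (2 * Real.pi * n i : ℝ) * Complex.I * fCoeff d f n := by
  set f' : (Fin d → ℝ) → ℝ := fun x => fderiv ℝ f x (Pi.single i 1) with hf'
  have hcf : Continuous f := hf.continuous
  have hcf' : Continuous f' := by
    have := hf.continuous_fderiv (by simp)
    fun_prop
  have hpf' : IntPeriodic f' := hp.fderiv_apply _
  have hpe := intPeriodic_fchar_neg_dotInt n
  have hdot : ∀ (x : Fin d → ℝ) (t : ℝ),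
      dotInt n (x + t • Pi.single i (1 : ℝ)) = dotInt n x + t * n i := by
    intro x t
    rw [dotInt_add]
    congr 1
    simp [dotInt, Pi.single_apply, mul_comm]
  have key := IntPeriodic.setIntegral_deriv_eq_zero
    (h := fun x => (f x : ℂ) * fchar (-dotInt n x))
    (h' := fun x => (f' x : ℂ) * fchar (-dotInt n x) -
      (2 * Real.pi * n i : ℝ) * Complex.I * ((f x : ℂ) * fchar (-dotInt n x)))
    (fun x m => by simp only [hp x m, hpe x m]) (by fun_prop)
    (fun x m => by simp only [hp x m, hpf' x m, hpe x m]) (by fun_prop) (Pi.single i 1) (by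
      intro x
      have h1 : HasDerivAt (fun t : ℝ => f (x + t • Pi.single i (1 : ℝ))) (f' x) 0 :=
        ((hf.differentiable (by simp)).differentiableAt.hasFDerivAt (x := x)).hasLineDerivAt _
      have h2 : HasDerivAt (fun t : ℝ => fchar (-dotInt n (x + t • Pi.single i (1 : ℝ))))
          (fchar (-dotInt n x) * (((2 * Real.pi * (-(1 * n i)) : ℝ) : ℂ) * Complex.I)) 0 := by
        simp only [hdot, fchar]
        have h3 : HasDerivAt (fun t : ℝ => 2 * Real.pi * (-(dotInt n x + t * n i)))
            (2 * Real.pi * (-(1 * n i))) 0 :=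
          ((((hasDerivAt_id (0 : ℝ)).mul_const (n i : ℝ)).const_add _).neg).const_mul _
        convert! ((h3.ofReal_comp).mul_const Complex.I).cexp using 1
        simp
      convert! h1.ofReal_comp.mul h2 using 1
      simp
      ring)
  rw [integral_sub (Continuous.integrableOn_cube (by fun_prop))
    (Continuous.integrableOn_cube (by fun_prop)), integral_const_mul, sub_eq_zero] at key
  exact key

lemma norm_fCoeff_le {d : ℕ} {f : (Fin d → ℝ) → ℝ} {C : ℝ} (hC : ∀ x, ‖f x‖ ≤ C)
    (n : Fin d → ℤ) : ‖fCoeff d f n‖ ≤ C := by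
  have h := norm_integral_le_of_norm_le_const (μ := volume.restrict (cube d))
    (f := fun x => (f x : ℂ) * fchar (-(∑ i, (n i : ℝ) * x i))) (C := C)
    (Filter.Eventually.of_forall fun x => by
      rw [norm_mul, norm_fchar, mul_one, Complex.norm_real]
      exact hC x)
  simpa [fCoeff] using h

lemma exists_abs_pow_mul_norm_fCoeff_le {d : ℕ} (i : Fin d) (k : ℕ) :
    ∀ {f : (Fin d → ℝ) → ℝ}, ContDiff ℝ (⊤ : ℕ∞) f → IntPeriodic f →
      ∃ C, ∀ n, |(n i : ℝ)| ^ k * ‖fCoeff d f n‖ ≤ C := by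
  induction k with
  | zero =>
    intro f hf hp
    obtain ⟨C, -, hC⟩ := hp.exists_norm_le hf.continuous
    exact ⟨C, fun n => by simpa using norm_fCoeff_le hC n⟩
  | succ k ih =>
    intro f hf hp
    obtain ⟨C, hC⟩ := ih (f := fun x => fderiv ℝ f x (Pi.single i 1))
      ((hf.fderiv_right (m := (⊤ : ℕ∞)) (by simp)).clm_apply contDiff_const)
      (hp.fderiv_apply _)
    refine ⟨C, fun n => le_trans ?_ (hC n)⟩
    rw [fCoeff_fderiv hf hp, norm_mul, norm_mul, Complex.norm_I, Complex.norm_real, mul_one,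
      Real.norm_eq_abs, abs_mul, abs_of_pos Real.two_pi_pos, pow_succ]
    have h1 : (1 : ℝ) ≤ 2 * Real.pi := by linarith [Real.pi_gt_three]
    calc |(n i : ℝ)| ^ k * |(n i : ℝ)| * ‖fCoeff d f n‖
        = 1 * (|(n i : ℝ)| ^ k * |(n i : ℝ)| * ‖fCoeff d f n‖) := by ring
      _ ≤ 2 * Real.pi * (|(n i : ℝ)| ^ k * |(n i : ℝ)| * ‖fCoeff d f n‖) := by gcongr
      _ = _ := by ring

lemma exists_norm_pow_mul_norm_fCoeff_le {d : ℕ} (hd : 1 ≤ d) (k : ℕ) {f : (Fin d → ℝ) → ℝ}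
    (hf : ContDiff ℝ (⊤ : ℕ∞) f) (hp : IntPeriodic f) :
    ∃ C, ∀ n : Fin d → ℤ, ‖n‖ ^ k * ‖fCoeff d f n‖ ≤ C := by
  choose C hC using fun i : Fin d => exists_abs_pow_mul_norm_fCoeff_le i k hf hp
  refine ⟨∑ i, |C i|, fun n => ?_⟩
  have : Nonempty (Fin d) := ⟨⟨0, hd⟩⟩
  obtain ⟨i, hi⟩ := (Finite.exists_max fun i => ‖n i‖)
  have hn : ‖n‖ = |(n i : ℝ)| := le_antisymm
    ((pi_norm_le_iff_of_nonneg (abs_nonneg _)).2 fun j => by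
      simpa [Int.norm_eq_abs] using hi j) (by simpa [Int.norm_eq_abs] using norm_le_pi_norm n i)
  rw [hn]
  exact (hC i n).trans ((le_abs_self _).trans
    (Finset.single_le_sum (f := fun i => |C i|) (fun _ _ => abs_nonneg _) (Finset.mem_univ i)))

lemma summable_norm_inv_pow (d : ℕ) : Summable fun n : Fin d → ℤ => ‖n‖⁻¹ ^ (d + 1) := by
  set L : Submodule ℤ (Fin d → ℝ) := Submodule.span ℤ (Set.range (Pi.basisFun ℝ (Fin d)))
  have hL := ZLattice.summable_norm_pow_inv L (d + 1) (by
    rw [ZLattice.rank ℝ L]; simp)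
  have hmem : ∀ n : Fin d → ℤ, (fun i => (n i : ℝ)) ∈ L := fun n =>
    ((Pi.basisFun ℝ (Fin d)).mem_span_iff_repr_mem ℤ _).2 fun i => ⟨n i, by simp⟩
  have hinj : Function.Injective fun n : Fin d → ℤ => (⟨fun i => (n i : ℝ), hmem n⟩ : L) := by
    intro a b hab
    ext i
    have h : ((a i : ℤ) : ℝ) = b i := congrFun (congrArg Subtype.val hab) i
    exact_mod_cast h
  refine (hL.comp_injective hinj).congr fun n => ?_
  have : ‖(fun i => (n i : ℝ))‖ = ‖n‖ := by
    have h (i : Fin d) : ‖(n i : ℝ)‖₊ = ‖n i‖₊ := rfl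
    simp only [Pi.norm_def, h]
  simp [this]

lemma one_le_norm_of_ne_zero {d : ℕ} {n : Fin d → ℤ} (hn : n ≠ 0) : 1 ≤ ‖n‖ := by
  obtain ⟨i, hi⟩ := Function.ne_iff.1 hn
  refine le_trans ?_ (norm_le_pi_norm n i)
  rw [Int.norm_eq_abs]
  exact_mod_cast Int.one_le_abs hi

lemma summable_norm_sq_mul_norm_fCoeff {d : ℕ} (hd : 1 ≤ d) {f : (Fin d → ℝ) → ℝ}
    (hf : ContDiff ℝ (⊤ : ℕ∞) f) (hp : IntPeriodic f) :
    Summable fun n : Fin d → ℤ => ‖n‖ ^ 2 * ‖fCoeff d f n‖ := by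
  obtain ⟨C, hC⟩ := exists_norm_pow_mul_norm_fCoeff_le hd (d + 1 + 2) hf hp
  refine Summable.of_nonneg_of_le (fun n => by positivity) (fun n => ?_)
    ((summable_norm_inv_pow d).mul_left C)
  rcases eq_or_ne n 0 with rfl | hn
  · simp
  · have h1 : 0 < ‖n‖ := norm_pos_iff.2 hn
    rw [inv_pow, ← div_eq_mul_inv, le_div_iff₀ (by positivity)]
    refine le_trans (le_of_eq ?_) (hC n)
    ring

lemma summable_norm_fCoeff {d : ℕ} (hd : 1 ≤ d) {f : (Fin d → ℝ) → ℝ}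
    (hf : ContDiff ℝ (⊤ : ℕ∞) f) (hp : IntPeriodic f) (hm : ∫ x in cube d, f x = 0) :
    Summable fun n : Fin d → ℤ => ‖fCoeff d f n‖ := by
  refine Summable.of_nonneg_of_le (fun n => norm_nonneg _) (fun n => ?_)
    (summable_norm_sq_mul_norm_fCoeff hd hf hp)
  rcases eq_or_ne n 0 with rfl | hn
  · simp [fCoeff_zero hm]
  · exact le_mul_of_one_le_left (norm_nonneg _) (one_le_pow₀ (one_le_norm_of_ne_zero hn))

/-- The Fourier symbol of the fractional Laplacian. -/
def fracSymbol {d : ℕ} (α : ℝ) (n : Fin d → ℤ) : ℝ :=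
  (2 * Real.pi * Real.sqrt (∑ i, (n i : ℝ) ^ 2)) ^ α

lemma fracSymbol_nonneg {d : ℕ} (α : ℝ) (n : Fin d → ℤ) : 0 ≤ fracSymbol α n := by
  unfold fracSymbol
  positivity

lemma summable_fracSymbol_mul_norm_fCoeff {d : ℕ} (hd : 1 ≤ d) {α : ℝ} (hα0 : 0 < α)
    (hα2 : α < 2) {f : (Fin d → ℝ) → ℝ} (hf : ContDiff ℝ (⊤ : ℕ∞) f) (hp : IntPeriodic f) :
    Summable fun n : Fin d → ℤ => fracSymbol α n * ‖fCoeff d f n‖ := by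
  refine Summable.of_nonneg_of_le
    (fun n => mul_nonneg (fracSymbol_nonneg α n) (norm_nonneg _)) (fun n => ?_)
    ((summable_norm_sq_mul_norm_fCoeff hd hf hp).mul_left ((2 * Real.pi * Real.sqrt d) ^ α))
  rw [← mul_assoc]
  gcongr
  have h1 : Real.sqrt (∑ i, (n i : ℝ) ^ 2) ≤ Real.sqrt d * ‖n‖ := by
    rw [← Real.sqrt_sq (norm_nonneg n), ← Real.sqrt_mul (by positivity)]
    apply Real.sqrt_le_sqrt
    calc ∑ i, (n i : ℝ) ^ 2 ≤ ∑ _i : Fin d, ‖n‖ ^ 2 := by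
          refine Finset.sum_le_sum fun i _ => ?_
          rw [← sq_abs, ← Int.norm_eq_abs]
          exact pow_le_pow_left₀ (norm_nonneg _) (norm_le_pi_norm n i) 2
      _ = d * ‖n‖ ^ 2 := by simp
  calc fracSymbol α n ≤ (2 * Real.pi * (Real.sqrt d * ‖n‖)) ^ α := by
        unfold fracSymbol
        gcongr
    _ = (2 * Real.pi * Real.sqrt d) ^ α * ‖n‖ ^ α := by
        rw [← mul_assoc, Real.mul_rpow (by positivity) (by positivity)]
    _ ≤ (2 * Real.pi * Real.sqrt d) ^ α * ‖n‖ ^ 2 := by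
        gcongr
        rcases eq_or_ne n 0 with rfl | hn
        · simp [Real.zero_rpow hα0.ne']
        · rw [← Real.rpow_natCast]
          exact Real.rpow_le_rpow_of_exponent_le (one_le_norm_of_ne_zero hn) (by simpa using hα2.le)

/-! ### The Lévy–Khintchine formula for the fractional symbol -/

section Kernel

variable {V : Type*} [NormedAddCommGroup V] [InnerProductSpace ℝ V] [FiniteDimensional ℝ V]
  [MeasurableSpace V] [BorelSpace V] [Nontrivial V]

open Module

lemma integrable_norm_rpow_mul_one_sub_cos {α : ℝ} (hα0 : 0 < α) (hα2 : α < 2) (ξ : V) :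
    Integrable fun y : V => ‖y‖ ^ (-(finrank ℝ V + α)) * (1 - Real.cos (inner ℝ ξ y)) := by
  set s : ℝ := -(finrank ℝ V + α) with hs
  set a : ℝ := ‖ξ‖ ^ 2 / 2 with ha
  let F : ℝ → ℝ := fun r => if r ≤ 1 then a * (r ^ 2 * r ^ s) else 2 * r ^ s
  have hdim : 1 ≤ finrank ℝ V := finrank_pos
  have hexp : ∀ r : ℝ, 0 < r → r ^ (finrank ℝ V - 1) * r ^ s = r ^ (-1 - α) := by
    intro r hr
    rw [← Real.rpow_natCast, ← Real.rpow_add hr]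
    congr 1
    rw [Nat.cast_sub hdim, hs]
    push_cast
    ring
  have hF : Integrable fun y : V => F ‖y‖ := by
    rw [integrable_fun_norm_addHaar volume (f := F), ← Set.Ioc_union_Ioi_eq_Ioi zero_le_one]
    refine IntegrableOn.union ?_ ?_
    · have h1 : IntegrableOn (fun r : ℝ => a * r ^ (1 - α)) (Set.Ioc 0 1) :=
        ((intervalIntegrable_iff_integrableOn_Ioc_of_le zero_le_one).1
          (intervalIntegral.intervalIntegrable_rpow' (by linarith))).const_mul a
      refine h1.congr_fun (fun r hr => ?_) measurableSet_Ioc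
      simp only [F, if_pos hr.2, smul_eq_mul]
      rw [mul_left_comm, mul_left_comm _ (r ^ 2), hexp r hr.1, ← Real.rpow_natCast,
        ← Real.rpow_add hr.1]
      congr 2
      push_cast
      ring
    · have h1 : IntegrableOn (fun r : ℝ => 2 * r ^ (-1 - α)) (Set.Ioi 1) :=
        (integrableOn_Ioi_rpow_of_lt (by linarith) one_pos).const_mul 2
      refine h1.congr_fun (fun r hr => ?_) measurableSet_Ioi
      simp only [F, if_neg (not_le.2 (Set.mem_Ioi.1 hr)), smul_eq_mul]
      rw [mul_left_comm, hexp r (one_pos.trans hr)]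
  refine hF.mono' (Measurable.aestronglyMeasurable (by fun_prop))
    (Filter.Eventually.of_forall fun y => ?_)
  have h0 : 0 ≤ 1 - Real.cos (inner ℝ ξ y) := by linarith [Real.cos_le_one (inner ℝ ξ y)]
  have hp : 0 ≤ ‖y‖ ^ s := by positivity
  rw [Real.norm_of_nonneg (mul_nonneg hp h0)]
  simp only [F]
  split_ifs with h
  · have h1 : 1 - Real.cos (inner ℝ ξ y) ≤ a * ‖y‖ ^ 2 := by
      have h2 := Real.one_sub_sq_div_two_le_cos (x := inner ℝ ξ y)
      have h3 : (inner ℝ ξ y) ^ 2 ≤ (‖ξ‖ * ‖y‖) ^ 2 := by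
        rw [← sq_abs]
        exact pow_le_pow_left₀ (abs_nonneg _) (abs_real_inner_le_norm ξ y) 2
      rw [ha]
      nlinarith
    calc ‖y‖ ^ s * (1 - Real.cos (inner ℝ ξ y)) ≤ ‖y‖ ^ s * (a * ‖y‖ ^ 2) := by gcongr
      _ = _ := by ring
  · rw [mul_comm]
    gcongr
    linarith [Real.neg_one_le_cos (inner ℝ ξ y)]

lemma exists_integral_norm_rpow_mul_one_sub_cos {α : ℝ} (hα0 : 0 < α) :
    ∃ C : ℝ, ∀ ξ : V, ∫ y : V, ‖y‖ ^ (-(finrank ℝ V + α)) * (1 - Real.cos (inner ℝ ξ y)) =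
      C * ‖ξ‖ ^ α := by
  obtain ⟨e, he⟩ := exists_norm_eq V zero_le_one
  set s : ℝ := -(finrank ℝ V + α) with hs
  refine ⟨∫ y : V, ‖y‖ ^ s * (1 - Real.cos (inner ℝ e y)), fun ξ => ?_⟩
  rcases eq_or_ne ξ 0 with rfl | hξ
  · simp [Real.zero_rpow hα0.ne']
  have hr : 0 < ‖ξ‖ := norm_pos_iff.2 hξ
  have hnorm : ‖‖ξ‖ • e‖ = ‖ξ‖ := by rw [norm_smul, he, norm_norm, mul_one]
  set R : V ≃ₗᵢ[ℝ] V := (ℝ ∙ (‖ξ‖ • e - ξ))ᗮ.reflection with hR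
  have hRe : R (‖ξ‖ • e) = ξ := Submodule.reflection_sub hnorm
  have hrot : ∫ y : V, ‖y‖ ^ s * (1 - Real.cos (inner ℝ ξ y)) =
      ∫ y : V, ‖y‖ ^ s * (1 - Real.cos (inner ℝ (‖ξ‖ • e) y)) := by
    rw [← R.measurePreserving.integral_comp R.toHomeomorph.measurableEmbedding]
    refine integral_congr_ae (Filter.Eventually.of_forall fun y => ?_)
    have h1 : inner ℝ ξ (R y) = inner ℝ (‖ξ‖ • e) y := by
      conv_lhs => rw [← hRe]
      exact R.inner_map_map _ _
    simp only [h1, R.norm_map]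
  have hscale : ∀ y : V, ‖y‖ ^ s * (1 - Real.cos (inner ℝ (‖ξ‖ • e) y)) =
      ‖ξ‖ ^ (-s) * (‖‖ξ‖ • y‖ ^ s * (1 - Real.cos (inner ℝ e (‖ξ‖ • y)))) := by
    intro y
    rw [norm_smul, norm_norm, Real.mul_rpow hr.le (norm_nonneg _), real_inner_smul_left,
      real_inner_smul_right, mul_assoc, ← mul_assoc (‖ξ‖ ^ (-s)), ← Real.rpow_add hr,
      neg_add_cancel, Real.rpow_zero, one_mul]
  rw [hrot]
  simp_rw [hscale]
  rw [integral_const_mul,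
    Measure.integral_comp_smul volume (fun y : V => ‖y‖ ^ s * (1 - Real.cos (inner ℝ e y))) ‖ξ‖,
    smul_eq_mul, abs_of_pos (by positivity), ← mul_assoc, mul_comm (∫ y : V, _)]
  congr 1
  rw [← Real.rpow_natCast, ← Real.rpow_neg hr.le, ← Real.rpow_add hr]
  congr 1
  rw [hs]
  ring

end Kernel

/-- The kernel `|y|^{-(d+α)}` on `ℝ^d`. -/
def fracKernel (d : ℕ) (α : ℝ) (y : Fin d → ℝ) : ℝ :=
  Real.sqrt (∑ i, y i ^ 2) ^ (-(d + α))

lemma fracKernel_toLp {d : ℕ} (α : ℝ) (y : EuclideanSpace ℝ (Fin d)) :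
    ‖y‖ ^ (-(Module.finrank ℝ (EuclideanSpace ℝ (Fin d)) + α)) = fracKernel d α y.ofLp := by
  rw [fracKernel, EuclideanSpace.norm_eq, finrank_euclideanSpace_fin]
  simp

lemma inner_toLp_intCast {d : ℕ} (n : Fin d → ℤ) (y : EuclideanSpace ℝ (Fin d)) :
    inner ℝ (WithLp.toLp 2 fun i => 2 * Real.pi * (n i : ℝ)) y =
      2 * Real.pi * dotInt n y.ofLp := by
  simp only [PiLp.inner_apply, dotInt, Finset.mul_sum]
  refine Finset.sum_congr rfl fun i _ => ?_
  simp
  ring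

lemma norm_toLp_intCast_rpow {d : ℕ} (α : ℝ) (n : Fin d → ℤ) :
    ‖(WithLp.toLp 2 fun i => 2 * Real.pi * (n i : ℝ) : EuclideanSpace ℝ (Fin d))‖ ^ α =
      fracSymbol α n := by
  have h : 2 * Real.pi * Real.sqrt (∑ i, (n i : ℝ) ^ 2) =
      Real.sqrt (∑ i, (2 * Real.pi * (n i : ℝ)) ^ 2) := by
    simp_rw [mul_pow (2 * Real.pi)]
    rw [← Finset.mul_sum, Real.sqrt_mul (by positivity), Real.sqrt_sq Real.two_pi_pos.le]
  simp only [fracSymbol, EuclideanSpace.norm_eq, h, Real.norm_eq_abs, sq_abs]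

lemma integrable_fracKernel_mul {d : ℕ} (hd : 1 ≤ d) {α : ℝ} (hα0 : 0 < α) (hα2 : α < 2)
    (n : Fin d → ℤ) :
    Integrable fun y => fracKernel d α y * (1 - Real.cos (2 * Real.pi * dotInt n y)) := by
  have : Nonempty (Fin d) := ⟨⟨0, hd⟩⟩
  have h := integrable_norm_rpow_mul_one_sub_cos hα0 hα2
    (WithLp.toLp 2 fun i => 2 * Real.pi * (n i : ℝ) : EuclideanSpace ℝ (Fin d))
  simp only [fracKernel_toLp, inner_toLp_intCast] at h
  exact ((PiLp.volume_preserving_toLp (Fin d)).integrable_comp_emb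
    (MeasurableEquiv.toLp 2 (Fin d → ℝ)).measurableEmbedding).2 h

lemma exists_integral_fracKernel {d : ℕ} (hd : 1 ≤ d) {α : ℝ} (hα0 : 0 < α) :
    ∃ C : ℝ, ∀ n : Fin d → ℤ,
      ∫ y, fracKernel d α y * (1 - Real.cos (2 * Real.pi * dotInt n y)) = C * fracSymbol α n := by
  have : Nonempty (Fin d) := ⟨⟨0, hd⟩⟩
  obtain ⟨C, hC⟩ :=
    exists_integral_norm_rpow_mul_one_sub_cos (V := EuclideanSpace ℝ (Fin d)) hα0
  refine ⟨C, fun n => ?_⟩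
  have h := hC (WithLp.toLp 2 fun i => 2 * Real.pi * (n i : ℝ))
  simp only [fracKernel_toLp, inner_toLp_intCast, norm_toLp_intCast_rpow] at h
  rw [← h]
  exact (PiLp.volume_preserving_toLp (Fin d)).integral_comp
    (MeasurableEquiv.toLp 2 (Fin d → ℝ)).measurableEmbedding
    (fun y => fracKernel d α y.ofLp * (1 - Real.cos (2 * Real.pi * dotInt n y.ofLp)))

/-- The lower bound of the kernel on the unit cube. -/
def kernelBound (d : ℕ) (α : ℝ) : ℝ := Real.sqrt d ^ (-(d + α))

lemma kernelBound_pos {d : ℕ} (hd : 1 ≤ d) (α : ℝ) : 0 < kernelBound d α :=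
  Real.rpow_pos_of_pos (Real.sqrt_pos.2 (by exact_mod_cast hd)) _

lemma kernelBound_le_fracKernel {d : ℕ} {α : ℝ} (hα0 : 0 < α) {y : Fin d → ℝ}
    (hy : y ∈ cube d) (hy0 : y ≠ 0) : kernelBound d α ≤ fracKernel d α y := by
  obtain ⟨i, hi⟩ := Function.ne_iff.1 hy0
  have hpos : 0 < ∑ i, y i ^ 2 :=
    Finset.sum_pos' (fun _ _ => sq_nonneg _) ⟨i, Finset.mem_univ _, by
      have : y i ≠ 0 := hi
      positivity⟩
  refine Real.rpow_le_rpow_of_nonpos (Real.sqrt_pos.2 hpos) (Real.sqrt_le_sqrt ?_) (by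
    have : (0 : ℝ) ≤ d := by positivity
    linarith)
  calc ∑ i, y i ^ 2 ≤ ∑ _i : Fin d, (1 : ℝ) := by
        refine Finset.sum_le_sum fun i _ => ?_
        have h := hy i (Set.mem_univ i)
        exact pow_le_one₀ h.1 h.2
    _ = d := by simp

/-- The kernel with a multiple of the uniform measure on the unit cube removed. -/
def residualKernel (d : ℕ) (α : ℝ) (y : Fin d → ℝ) : ℝ :=
  fracKernel d α y - (cube d).indicator (fun _ => kernelBound d α) y

lemma residualKernel_nonneg {d : ℕ} {α : ℝ} (hα0 : 0 < α) {y : Fin d → ℝ} (hy0 : y ≠ 0) :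
    0 ≤ residualKernel d α y := by
  by_cases hy : y ∈ cube d
  · simpa [residualKernel, hy] using kernelBound_le_fracKernel hα0 hy hy0
  · simp only [residualKernel, hy, not_false_eq_true, Set.indicator_of_notMem, sub_zero]
    unfold fracKernel
    positivity

lemma setIntegral_cube_cos {d : ℕ} {n : Fin d → ℤ} (hn : n ≠ 0) :
    ∫ y in cube d, Real.cos (2 * Real.pi * dotInt n y) = 0 := by
  obtain ⟨i, hi⟩ := Function.ne_iff.1 hn
  have h := fCoeff_fderiv (f := fun _ : Fin d → ℝ => 1) contDiff_const (fun _ _ => rfl) i n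
  have h0 : fCoeff d (fun _ => 1) n = 0 := by
    have h1 : (2 * Real.pi * n i : ℝ) ≠ 0 := by
      have : (n i : ℝ) ≠ 0 := by exact_mod_cast hi
      positivity
    have h2 : fCoeff d (fun x => fderiv ℝ (fun _ : Fin d → ℝ => (1 : ℝ)) x (Pi.single i 1)) n
        = 0 := by simp [fCoeff]
    rw [h2] at h
    have h3 : ((2 * Real.pi * n i : ℝ) : ℂ) * Complex.I ≠ 0 :=
      mul_ne_zero (Complex.ofReal_ne_zero.2 h1) Complex.I_ne_zero
    exact (mul_eq_zero.1 h.symm).resolve_left h3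
  have hre : ∀ y : Fin d → ℝ, Real.cos (2 * Real.pi * dotInt n y) = (fchar (-dotInt n y)).re := by
    intro y
    rw [fchar, Complex.exp_ofReal_mul_I_re, mul_neg, Real.cos_neg]
  simp_rw [hre]
  have h3 := Complex.reCLM.integral_comp_comm
    (Continuous.integrableOn_cube (h := fun y => fchar (-dotInt n y)) (by fun_prop))
  simp only [Complex.reCLM_apply] at h3
  rw [h3]
  have h4 : ∫ y in cube d, fchar (-dotInt n y) = 0 := by simpa [fCoeff, dotInt] using h0
  rw [h4, Complex.zero_re]

lemma integrable_indicator_cube_mul {d : ℕ} (κ : ℝ) (n : Fin d → ℤ) :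
    Integrable fun y =>
      (cube d).indicator (fun _ => κ) y * (1 - Real.cos (2 * Real.pi * dotInt n y)) := by
  have h : IntegrableOn (fun y => κ * (1 - Real.cos (2 * Real.pi * dotInt n y))) (cube d) :=
    Continuous.integrableOn_cube (by fun_prop)
  refine (h.integrable_indicator (measurableSet_cube d)).congr
    (Filter.Eventually.of_forall fun y => ?_)
  by_cases hy : y ∈ cube d <;> simp [hy]

lemma integral_indicator_cube_mul {d : ℕ} (κ : ℝ) {n : Fin d → ℤ} (hn : n ≠ 0) :
    ∫ y, (cube d).indicator (fun _ => κ) y * (1 - Real.cos (2 * Real.pi * dotInt n y)) = κ := by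
  have h : ∀ y, (cube d).indicator (fun _ => κ) y * (1 - Real.cos (2 * Real.pi * dotInt n y)) =
      (cube d).indicator (fun y => κ * (1 - Real.cos (2 * Real.pi * dotInt n y))) y := fun y => by
    by_cases hy : y ∈ cube d <;> simp [hy]
  simp_rw [h]
  rw [integral_indicator (measurableSet_cube d), integral_const_mul,
    integral_sub (integrable_const _) (Continuous.integrableOn_cube (by fun_prop)),
    setIntegral_cube_cos hn]
  simp

lemma integrable_residualKernel_mul {d : ℕ} (hd : 1 ≤ d) {α : ℝ} (hα0 : 0 < α) (hα2 : α < 2)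
    (n : Fin d → ℤ) :
    Integrable fun y => residualKernel d α y * (1 - Real.cos (2 * Real.pi * dotInt n y)) := by
  simp only [residualKernel, sub_mul]
  exact (integrable_fracKernel_mul hd hα0 hα2 n).sub (integrable_indicator_cube_mul _ n)

lemma integral_residualKernel_mul {d : ℕ} (hd : 1 ≤ d) {α : ℝ} (hα0 : 0 < α) (hα2 : α < 2) {C : ℝ}
    (hC : ∀ n : Fin d → ℤ,
      ∫ y, fracKernel d α y * (1 - Real.cos (2 * Real.pi * dotInt n y)) = C * fracSymbol α n)
    {n : Fin d → ℤ} (hn : n ≠ 0) :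
    ∫ y, residualKernel d α y * (1 - Real.cos (2 * Real.pi * dotInt n y)) =
      C * fracSymbol α n - kernelBound d α := by
  simp only [residualKernel, sub_mul]
  rw [integral_sub (integrable_fracKernel_mul hd hα0 hα2 n) (integrable_indicator_cube_mul _ n),
    hC, integral_indicator_cube_mul _ hn]

lemma residualKernel_mul_nonneg {d : ℕ} {α : ℝ} (hα0 : 0 < α) (n : Fin d → ℤ) (y : Fin d → ℝ) :
    0 ≤ residualKernel d α y * (1 - Real.cos (2 * Real.pi * dotInt n y)) := by
  rcases eq_or_ne y 0 with rfl | hy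
  · simp [dotInt_zero]
  · exact mul_nonneg (residualKernel_nonneg hα0 hy) (sub_nonneg.2 (Real.cos_le_one _))

/-! ### The dual power and the bilinear form -/

/-- The dual power `|t|^{q-2} t`. -/
def dualPow (q t : ℝ) : ℝ := |t| ^ (q - 2) * t

lemma dualPow_of_nonneg {q t : ℝ} (hq : 1 < q) (ht : 0 ≤ t) : dualPow q t = t ^ (q - 1) := by
  rcases ht.eq_or_lt with rfl | ht
  · simp [dualPow, Real.zero_rpow (sub_pos.2 hq).ne']
  · rw [dualPow, abs_of_pos ht, ← Real.rpow_add_one ht.ne']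
    congr 1
    ring

lemma dualPow_neg (q t : ℝ) : dualPow q (-t) = -dualPow q t := by simp [dualPow]

lemma dualPow_monotone {q : ℝ} (hq : 1 < q) : Monotone (dualPow q) := by
  refine monotone_of_odd_of_monotoneOn_nonneg (dualPow_neg q) fun s hs t ht hst => ?_
  rw [dualPow_of_nonneg hq hs, dualPow_of_nonneg hq ht]
  exact Real.rpow_le_rpow hs hst (sub_pos.2 hq).le

lemma dualPow_eq {q : ℝ} (hq : 1 < q) (t : ℝ) :
    dualPow q t = max t 0 ^ (q - 1) - max (-t) 0 ^ (q - 1) := by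
  rcases le_total 0 t with ht | ht
  · simp [dualPow_of_nonneg hq ht, ht, Real.zero_rpow (sub_pos.2 hq).ne']
  · have h := dualPow_of_nonneg hq (neg_nonneg.2 ht)
    rw [dualPow_neg] at h
    simp [← h, ht, Real.zero_rpow (sub_pos.2 hq).ne']

lemma continuous_dualPow {q : ℝ} (hq : 1 < q) : Continuous (dualPow q) := by
  have h : dualPow q = fun t => max t 0 ^ (q - 1) - max (-t) 0 ^ (q - 1) := funext (dualPow_eq hq)
  rw [h]
  have hq' : 0 ≤ q - 1 := (sub_pos.2 hq).le
  exact ((by fun_prop : Continuous fun t : ℝ => max t 0).rpow_const fun _ => Or.inr hq').sub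
    ((by fun_prop : Continuous fun t : ℝ => max (-t) 0).rpow_const fun _ => Or.inr hq')

lemma mul_dualPow {q : ℝ} (hq : 1 < q) (t : ℝ) : t * dualPow q t = |t| ^ q := by
  rcases eq_or_ne t 0 with rfl | ht
  · simp [Real.zero_rpow (one_pos.trans hq).ne']
  · have h : t * dualPow q t = |t| ^ (q - 2) * |t| ^ (2 : ℝ) := by
      rw [dualPow, Real.rpow_two, sq_abs]
      ring
    rw [h, ← Real.rpow_add (abs_pos.2 ht)]
    congr 1
    ring

/-- The coefficient `∫ e^{2πi n·x} g(x) dx`. -/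
def dualCoeff {d : ℕ} (g : (Fin d → ℝ) → ℝ) (n : Fin d → ℤ) : ℂ :=
  ∫ x in cube d, fchar (dotInt n x) * (g x : ℂ)

lemma norm_dualCoeff_le {d : ℕ} {g : (Fin d → ℝ) → ℝ} {C : ℝ} (hC : ∀ x, ‖g x‖ ≤ C)
    (n : Fin d → ℤ) : ‖dualCoeff g n‖ ≤ C := by
  have h := norm_integral_le_of_norm_le_const (μ := volume.restrict (cube d))
    (f := fun x => fchar (dotInt n x) * (g x : ℂ)) (C := C)
    (Filter.Eventually.of_forall fun x => by
      rw [norm_mul, norm_fchar, one_mul, Complex.norm_real]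
      exact hC x)
  simpa [dualCoeff] using h

/-- Termwise integration of an absolutely convergent Fourier series against a bounded continuous
function. -/
lemma hasSum_mul_dualCoeff {d : ℕ} {g : (Fin d → ℝ) → ℝ} (hg : Continuous g) {C : ℝ}
    (hC : ∀ x, ‖g x‖ ≤ C) {a : (Fin d → ℤ) → ℂ} (ha : Summable fun n => ‖a n‖) :
    HasSum (fun n => a n * dualCoeff g n)
      (∫ x in cube d, (∑' n, a n * fchar (dotInt n x)) * (g x : ℂ)) := by
  have h := hasSum_integral_of_summable_integral_norm (μ := volume.restrict (cube d))
    (F := fun n x => a n * (fchar (dotInt n x) * (g x : ℂ)))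
    (fun n => Continuous.integrableOn_cube (by fun_prop)) (by
      refine Summable.of_nonneg_of_le (fun n => integral_nonneg fun x => norm_nonneg _)
        (fun n => ?_) (ha.mul_right C)
      have h1 := integral_mono_of_nonneg (μ := volume.restrict (cube d))
        (f := fun x => ‖a n * (fchar (dotInt n x) * (g x : ℂ))‖) (g := fun _ => ‖a n‖ * C)
        (Filter.Eventually.of_forall fun x => norm_nonneg _) (integrable_const _)
        (Filter.Eventually.of_forall fun x => by
          simp only [norm_mul, norm_fchar, one_mul, Complex.norm_real]
          exact mul_le_mul_of_nonneg_left (hC x) (norm_nonneg _))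
      simpa using h1)
  simp only [integral_const_mul] at h
  convert! h using 3 with x
  rw [← tsum_mul_right]
  exact tsum_congr fun n => mul_assoc _ _ _

lemma hasSum_translate {d : ℕ} {f g : (Fin d → ℝ) → ℝ} (hf : Continuous f) (hp : IntPeriodic f)
    (hs : Summable fun n => ‖fCoeff d f n‖) (hg : Continuous g) {C : ℝ}
    (hC : ∀ x, ‖g x‖ ≤ C) (y : Fin d → ℝ) :
    HasSum (fun n => fCoeff d f n * dualCoeff g n * fchar (dotInt n y))
      ((∫ x in cube d, f (x + y) * g x : ℝ) : ℂ) := by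
  have h := hasSum_mul_dualCoeff hg hC (a := fun n => fCoeff d f n * fchar (dotInt n y))
    (by simpa [norm_fchar] using hs)
  have h1 : ∀ x, ∑' n, fCoeff d f n * fchar (dotInt n y) * fchar (dotInt n x) =
      (f (x + y) : ℂ) := fun x => by
    rw [← (hp.hasSum_fourier hf hs (x + y)).tsum_eq]
    refine tsum_congr fun n => ?_
    rw [dotInt_add, fchar_add]
    ring
  simp only [h1] at h
  rw [← integral_complex_ofReal]
  convert! h using 2
  · ring
  · simp

lemma hasSum_mul_one_sub_cos {d : ℕ} {f g : (Fin d → ℝ) → ℝ} (hf : Continuous f)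
    (hp : IntPeriodic f) (hs : Summable fun n => ‖fCoeff d f n‖) (hg : Continuous g)
    (hpg : IntPeriodic g) (y : Fin d → ℝ) :
    HasSum (fun n => fCoeff d f n * dualCoeff g n *
        ((1 - Real.cos (2 * Real.pi * dotInt n y) : ℝ) : ℂ))
      (((∫ x in cube d, (f (x + y) - f x) * (g (x + y) - g x)) / 2 : ℝ) : ℂ) := by
  obtain ⟨C, -, hC⟩ := hpg.exists_norm_le hg
  have h0 := hasSum_translate hf hp hs hg hC 0
  have h1 := hasSum_translate hf hp hs hg hC y
  have h2 := hasSum_translate hf hp hs hg hC (-y)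
  have hfg : IntPeriodic fun x => f x * g x := fun x n => by simp only [hp x n, hpg x n]
  have e1 : ∫ x in cube d, f (x + y) * g (x + y) = ∫ x in cube d, f x * g x :=
    hfg.setIntegral_add (by fun_prop) y
  have e2 : ∫ x in cube d, f x * g (x + y) = ∫ x in cube d, f (x + -y) * g x := by
    have hper : IntPeriodic fun x => f (x + -y) * g x := fun x n => by
      simp only [hpg x n, add_right_comm x _ (-y), hp (x + -y) n]
    rw [← hper.setIntegral_add (by fun_prop) y]
    simp
  have e3 : ∫ x in cube d, (f (x + y) - f x) * (g (x + y) - g x) =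
      2 * (∫ x in cube d, f x * g x) - (∫ x in cube d, f (x + y) * g x) -
        ∫ x in cube d, f (x + -y) * g x := by
    have hsplit : ∀ x, (f (x + y) - f x) * (g (x + y) - g x) =
        (f (x + y) * g (x + y) + f x * g x) - (f (x + y) * g x + f x * g (x + y)) :=
      fun x => by ring
    simp_rw [hsplit]
    rw [integral_sub (Continuous.integrableOn_cube (by fun_prop))
        (Continuous.integrableOn_cube (by fun_prop)),
      integral_add (Continuous.integrableOn_cube (by fun_prop))
        (Continuous.integrableOn_cube (by fun_prop)),
      integral_add (Continuous.integrableOn_cube (by fun_prop))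
        (Continuous.integrableOn_cube (by fun_prop)), e1, e2]
    ring
  convert! h0.sub ((h1.add h2).div_const 2) using 1
  · ext n
    have hc := fchar_add_fchar_neg (dotInt n y)
    rw [dotInt_neg, dotInt_zero, fchar_zero, ← mul_add, hc]
    push_cast
    ring
  · rw [e3]
    simp only [add_zero]
    push_cast
    ring

lemma setIntegral_fracLapPer_mul {d : ℕ} {α : ℝ} {f g : (Fin d → ℝ) → ℝ}
    (hs : Summable fun n => fracSymbol α n * ‖fCoeff d f n‖) (hg : Continuous g)
    (hpg : IntPeriodic g) :
    HasSum (fun n => (fracSymbol α n * (fCoeff d f n * dualCoeff g n)).re)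
      (∫ x in cube d, fracLapPer d α f x * g x) := by
  obtain ⟨C, -, hC⟩ := hpg.exists_norm_le hg
  have hs' : Summable fun n => ‖(fracSymbol α n : ℂ) * fCoeff d f n‖ := by
    refine hs.congr fun n => ?_
    rw [norm_mul, Complex.norm_real, Real.norm_of_nonneg (fracSymbol_nonneg α n)]
  have h := Complex.hasSum_re (hasSum_mul_dualCoeff hg hC hs')
  have hcont : Continuous fun x : Fin d → ℝ =>
      ∑' n, (fracSymbol α n : ℂ) * fCoeff d f n * fchar (dotInt n x) :=
    continuous_tsum (fun n => by fun_prop) hs' fun n x => by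
      rw [norm_mul _ (fchar _), norm_fchar, mul_one]
  have h3 := Complex.reCLM.integral_comp_comm (Continuous.integrableOn_cube
    (h := fun x : Fin d → ℝ =>
      (∑' n, (fracSymbol α n : ℂ) * fCoeff d f n * fchar (dotInt n x)) * (g x : ℂ))
    (by fun_prop))
  simp only [Complex.reCLM_apply, Complex.re_mul_ofReal] at h3
  rw [← h3] at h
  have hfrac : ∀ x, (∑' n, (fracSymbol α n : ℂ) * fCoeff d f n * fchar (dotInt n x)).re =
      fracLapPer d α f x := fun x => rfl
  simp only [hfrac] at h
  simpa only [mul_assoc] using h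

lemma kernelBound_mul_le {d : ℕ} (hd : 1 ≤ d) {α : ℝ} (hα0 : 0 < α) (hα2 : α < 2) {C : ℝ}
    (hC : ∀ n : Fin d → ℤ,
      ∫ y, fracKernel d α y * (1 - Real.cos (2 * Real.pi * dotInt n y)) = C * fracSymbol α n)
    {f g : (Fin d → ℝ) → ℝ} (hf : ContDiff ℝ (⊤ : ℕ∞) f) (hp : IntPeriodic f)
    (hm : ∫ x in cube d, f x = 0) (hg : Continuous g) (hpg : IntPeriodic g)
    (hfg : ∀ x y, 0 ≤ (f y - f x) * (g y - g x)) :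
    kernelBound d α * ∫ x in cube d, f x * g x ≤ C * ∫ x in cube d, fracLapPer d α f x * g x := by
  obtain ⟨M, hM0, hM⟩ := hpg.exists_norm_le hg
  have hs := summable_norm_fCoeff hd hf hp hm
  have hsA := summable_fracSymbol_mul_norm_fCoeff hd hα0 hα2 hf hp
  set w : (Fin d → ℤ) → ℂ := fun n => fCoeff d f n * dualCoeff g n with hw
  have hw0 : w 0 = 0 := by simp [hw, fCoeff_zero hm]
  have hwM : ∀ n, ‖w n‖ ≤ M * ‖fCoeff d f n‖ := fun n => by
    rw [hw, norm_mul, mul_comm]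
    exact mul_le_mul_of_nonneg_right (norm_dualCoeff_le hM n) (norm_nonneg _)
  set ρ : (Fin d → ℤ) → (Fin d → ℝ) → ℝ :=
    fun n y => residualKernel d α y * (1 - Real.cos (2 * Real.pi * dotInt n y)) with hρ
  have hρ0 : ∀ n y, 0 ≤ ρ n y := residualKernel_mul_nonneg hα0
  have hρint : ∀ n, Integrable (ρ n) := integrable_residualKernel_mul hd hα0 hα2
  have hwρ : ∀ n, w n * ((∫ y, ρ n y : ℝ) : ℂ) =
      w n * ((C * fracSymbol α n - kernelBound d α : ℝ) : ℂ) := fun n => by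
    rcases eq_or_ne n 0 with rfl | hn
    · simp [hw0]
    · rw [hρ, integral_residualKernel_mul hd hα0 hα2 hC hn]
  have hsum := hasSum_integral_of_summable_integral_norm (μ := volume)
    (F := fun n y => w n * (ρ n y : ℂ)) (fun n => ((hρint n).ofReal).const_mul _) (by
      have hnorm : ∀ n y, ‖w n * (ρ n y : ℂ)‖ = ‖w n‖ * ρ n y := fun n y => by
        rw [norm_mul, Complex.norm_real, Real.norm_of_nonneg (hρ0 n y)]
      simp only [hnorm, integral_const_mul]
      refine Summable.of_nonneg_of_le (fun n => mul_nonneg (norm_nonneg _)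
        (integral_nonneg (hρ0 n))) (fun n => ?_) ((hsA.mul_left (M * |C|)))
      rcases eq_or_ne n 0 with rfl | hn
      · rw [hw0, norm_zero, zero_mul]
        exact mul_nonneg (by positivity) (mul_nonneg (fracSymbol_nonneg α 0) (norm_nonneg _))
      · have h1 : ∫ y, ρ n y ≤ |C| * fracSymbol α n := by
          rw [hρ, integral_residualKernel_mul hd hα0 hα2 hC hn]
          have h2 := mul_le_mul_of_nonneg_right (le_abs_self C) (fracSymbol_nonneg α n)
          linarith [kernelBound_pos hd α]
        calc ‖w n‖ * ∫ y, ρ n y ≤ (M * ‖fCoeff d f n‖) * (|C| * fracSymbol α n) :=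
              mul_le_mul (hwM n) h1 (integral_nonneg (hρ0 n)) (by positivity)
          _ = _ := by ring)
  have hpoint : ∀ y, ∑' n, w n * (ρ n y : ℂ) = ((residualKernel d α y *
      ((∫ x in cube d, (f (x + y) - f x) * (g (x + y) - g x)) / 2) : ℝ) : ℂ) := fun y => by
    rw [Complex.ofReal_mul,
      ← (hasSum_mul_one_sub_cos hf.continuous hp hs hg hpg y).tsum_eq, ← tsum_mul_left]
    refine tsum_congr fun n => ?_
    simp only [hw, hρ]
    push_cast
    ring
  simp only [hpoint, integral_const_mul, integral_complex_ofReal, hwρ] at hsum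
  have hre := Complex.hasSum_re hsum
  have hnonneg : 0 ≤ ∫ y, residualKernel d α y *
      ((∫ x in cube d, (f (x + y) - f x) * (g (x + y) - g x)) / 2) := by
    refine integral_nonneg fun y => ?_
    rcases eq_or_ne y 0 with rfl | hy
    · simp
    · exact mul_nonneg (residualKernel_nonneg hα0 hy)
        (div_nonneg (integral_nonneg fun x => hfg _ _) zero_le_two)
  have h1 := (setIntegral_fracLapPer_mul hsA hg hpg).mul_left C
  have h2 := (Complex.hasSum_re (hasSum_translate hf.continuous hp hs hg hM 0)).mul_left
    (kernelBound d α)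
  have h3 := (h1.sub h2).unique (a₂ := ∫ y, residualKernel d α y *
      ((∫ x in cube d, (f (x + y) - f x) * (g (x + y) - g x)) / 2)) (by
    convert! hre using 1
    ext n
    rw [dotInt_zero, fchar_zero, mul_one, Complex.re_mul_ofReal, Complex.re_ofReal_mul]
    ring)
  simp only [add_zero, Complex.ofReal_re] at h3
  linarith

lemma kernelConst_pos {d : ℕ} (hd : 1 ≤ d) {α : ℝ} (hα0 : 0 < α) (hα2 : α < 2) {C : ℝ}
    (hC : ∀ n : Fin d → ℤ,
      ∫ y, fracKernel d α y * (1 - Real.cos (2 * Real.pi * dotInt n y)) = C * fracSymbol α n) :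
    0 < C := by
  have hn : (fun _ => 1 : Fin d → ℤ) ≠ 0 := fun h => one_ne_zero (congrFun h ⟨0, hd⟩)
  have h1 := integral_residualKernel_mul hd hα0 hα2 hC hn
  have h2 : 0 ≤ ∫ y, residualKernel d α y *
      (1 - Real.cos (2 * Real.pi * dotInt (fun _ => 1 : Fin d → ℤ) y)) :=
    integral_nonneg fun y => residualKernel_mul_nonneg hα0 _ y
  rw [h1] at h2
  have h3 : 0 < C * fracSymbol α (fun _ => 1 : Fin d → ℤ) := by
    have h4 := kernelBound_pos hd α
    linarith
  exact pos_of_mul_pos_left h3 (fracSymbol_nonneg α _)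

lemma eLpNorm_toReal_rpow {d : ℕ} {f : (Fin d → ℝ) → ℝ} (hf : Continuous f) {q : ℝ} (hq : 1 < q) :
    (eLpNorm f (ENNReal.ofReal q) (volume.restrict (cube d))).toReal ^ q =
      ∫ x in cube d, |f x| ^ q := by
  have hq0 : 0 < q := one_pos.trans hq
  obtain ⟨C, hC⟩ := (isCompact_cube d).exists_bound_of_continuousOn hf.continuousOn
  have hmem : MemLp f (ENNReal.ofReal q) (volume.restrict (cube d)) :=
    MemLp.of_bound hf.aestronglyMeasurable C
      ((ae_restrict_iff' (measurableSet_cube d)).2 (Filter.Eventually.of_forall hC))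
  have h0 : 0 ≤ ∫ x in cube d, |f x| ^ q := integral_nonneg fun x => by positivity
  rw [hmem.eLpNorm_eq_integral_rpow_norm (by simpa using hq0) ENNReal.ofReal_ne_top,
    ENNReal.toReal_ofReal hq0.le]
  simp only [Real.norm_eq_abs]
  rw [ENNReal.toReal_ofReal (by positivity), Real.rpow_inv_rpow h0 hq0.ne']

/-- generalized Poincaré-type inequality on the torus, 0 < α < 2,
with a constant depending only on α and d (independent of q). -/
theorem generalized_poincare_fractional
    (d : ℕ) (hd : 1 ≤ d) (α : ℝ) (hα0 : 0 < α) (hα2 : α < 2) :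
    ∃ c₁ : ℝ, 0 < c₁ ∧
      ∀ f : (Fin d → ℝ) → ℝ,
        ContDiff ℝ (⊤ : ℕ∞) f →
        (∀ (x : Fin d → ℝ) (n : Fin d → ℤ), f (x + fun i => (n i : ℝ)) = f x) →
        (∫ x in cube d, f x) = 0 →
      ∀ q : ℝ, 1 < q →
        (∫ x in cube d, fracLapPer d α f x * |f x| ^ (q - 2) * f x) ≥
          c₁ * (eLpNorm f (ENNReal.ofReal q) (volume.restrict (cube d))).toReal ^ q := by
  obtain ⟨C, hC⟩ := exists_integral_fracKernel hd hα0
  have hCpos := kernelConst_pos hd hα0 hα2 hC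
  refine ⟨kernelBound d α / C, div_pos (kernelBound_pos hd α) hCpos, fun f hf hp hm q hq => ?_⟩
  have h := kernelBound_mul_le hd hα0 hα2 hC hf hp hm
    (g := fun x => dualPow q (f x)) ((continuous_dualPow hq).comp hf.continuous)
    (fun x n => by simp only [hp x n]) (fun x y => by
      rcases le_total (f x) (f y) with h | h
      · exact mul_nonneg (sub_nonneg.2 h) (sub_nonneg.2 (dualPow_monotone hq h))
      · exact mul_nonneg_of_nonpos_of_nonpos (sub_nonpos.2 h)
          (sub_nonpos.2 (dualPow_monotone hq h)))
  simp only [mul_dualPow hq] at h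
  rw [eLpNorm_toReal_rpow hf.continuous hq, ge_iff_le, div_mul_eq_mul_div, div_le_iff₀' hCpos]
  simpa only [dualPow, mul_assoc] using h

end
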